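/- For any two mm-spaces X and Y, H̲_0Lι_1(X,Y) ≤ □̲_0(X,Y) ≤ 2·H̲_0Lι_1(X,Y). -/

import Mathlib

open MeasureTheory Set Filter Topology

noncomputable section

/-- Lebesgue measure restricted to the interval `[0, m]`. -/
def lebIcc (m : ℝ) : Measure ℝ := volume.restrict (Icc 0 m)

/-- `φ : [0,m] → X` is a parameter of the mm-space `(X, d_X, μX)`:
a Borel measurable map pushing Lebesgue measure on `[0,m]` forward to `μX`. -/
def IsParameter {X : Type*} [MeasurableSpace X] (μX : Measure X) (m : ℝ) (φ : ℝ → X) : Prop :=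
  Measurable φ ∧ Measure.map φ (lebIcc m) = μX

/-- The pullback `φ*d_X` of the distance of `X` under `φ`. -/
def pb {X : Type*} [PseudoMetricSpace X] (φ : ℝ → X) : ℝ → ℝ → ℝ :=
  fun s t => dist (φ s) (φ t)

/-- The distance `□_λ(d₁, d₂)` between two maps `d₁ d₂ : α × α → ℝ` over a finite
measure space `(α, μ)`. -/
def boxDist {α : Type*} [MeasurableSpace α] (μ : Measure α) (lam : ℝ)
    (d₁ d₂ : α → α → ℝ) : ℝ :=
  sInf {ε : ℝ | 0 < ε ∧ ∃ T : Set α, MeasurableSet T ∧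
    (μ univ).toReal - lam * ε ≤ (μ T).toReal ∧
    ∀ x ∈ T, ∀ y ∈ T, |d₁ x y - d₂ x y| ≤ ε}

/-- `inf □_λ(φX*d_X, φY*d_Y)` over all parameters, for mm-spaces of equal total mass `m`. -/
def boxInf {X Y : Type*} [PseudoMetricSpace X] [MeasurableSpace X]
    [PseudoMetricSpace Y] [MeasurableSpace Y] (lam m : ℝ)
    (μX : Measure X) (μY : Measure Y) : ℝ :=
  sInf {r : ℝ | ∃ (φX : ℝ → X) (φY : ℝ → Y), IsParameter μX m φX ∧ IsParameter μY m φY ∧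
    r = boxDist (lebIcc m) lam (pb φX) (pb φY)}

open Classical in
/-- Gromov's box distance `□̲_λ(X, Y)` between mm-spaces. -/
def mmBox {X Y : Type*} [PseudoMetricSpace X] [MeasurableSpace X]
    [PseudoMetricSpace Y] [MeasurableSpace Y] (lam : ℝ)
    (μX : Measure X) (μY : Measure Y) : ℝ :=
  if (μX univ).toReal = (μY univ).toReal then
    boxInf lam (μX univ).toReal μX μY
  else if (μX univ).toReal < (μY univ).toReal then
    boxInf lam (μX univ).toReal μX
      ((ENNReal.ofReal ((μX univ).toReal / (μY univ).toReal)) • μY)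
      + ((μY univ).toReal - (μX univ).toReal)
  else
    boxInf lam (μY univ).toReal
      ((ENNReal.ofReal ((μY univ).toReal / (μX univ).toReal)) • μX) μY
      + ((μX univ).toReal - (μY univ).toReal)

/-- The measure `μ̲_r` on `r × r` real matrices: the pushforward of `μ^r` under
`(x₁, …, x_r) ↦ (d(x_i, x_j))_{i,j}`, for a (pseudo)distance `d`. -/
def matMeasure {α : Type*} [MeasurableSpace α] (μ : Measure α) (d : α → α → ℝ) (r : ℕ) :
    Measure (Fin r → Fin r → ℝ) :=
  Measure.map (fun x : Fin r → α => fun i j => d (x i) (x j)) (Measure.pi fun _ : Fin r => μ)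

/-- The support of a Borel measure. -/
def msupport {X : Type*} [TopologicalSpace X] [MeasurableSpace X] (μ : Measure X) : Set X :=
  {x | ∀ U : Set X, IsOpen U → x ∈ U → 0 < μ U}

/-- Two mm-spaces are isomorphic: there is a measure preserving isometry (bijective)
between the supports of their measures. -/
def MMIsom {X Y : Type*} [MetricSpace X] [MeasurableSpace X] [MetricSpace Y] [MeasurableSpace Y]
    (μX : Measure X) (μY : Measure Y) : Prop :=
  ∃ f : msupport μX → msupport μY, Function.Bijective f ∧ Isometry f ∧
    Measure.map f (Measure.comap Subtype.val μX) = Measure.comap Subtype.val μY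

/-- The distance `me_λ` on the space of all real valued functions on `(α, μ)`. -/
def meDist {α : Type*} [MeasurableSpace α] (μ : Measure α) (lam : ℝ) (f g : α → ℝ) : ℝ :=
  sInf {ε : ℝ | 0 < ε ∧ (μ {x | ε ≤ |f x - g x|}).toReal ≤ lam * ε}

/-- The distance `me₁` for maps into a metric space. -/
def meDistMap {α Y : Type*} [MeasurableSpace α] [PseudoMetricSpace Y]
    (μ : Measure α) (f g : α → Y) : ℝ :=
  sInf {ε : ℝ | 0 < ε ∧ (μ {x | ε ≤ dist (f x) (g x)}).toReal ≤ ε}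

/-- `Lip_1(d)`: the real valued functions that are `1`-Lipschitz w.r.t. a semi-distance `d`. -/
def Lip1 {α : Type*} (d : α → α → ℝ) : Set (α → ℝ) := {f | ∀ x y, |f x - f y| ≤ d x y}

/-- `d` is a semi-distance function. -/
structure IsSemiDist {α : Type*} (d : α → α → ℝ) : Prop where
  refl : ∀ x, d x x = 0
  symm : ∀ x y, d x y = d y x
  triangle : ∀ x y z, d x z ≤ d x y + d y z

/-- `H_λLι₁(d, d')`: the Hausdorff distance between `Lip_1(d)` and `Lip_1(d')` in
`(𝓕(α, ℝ), me_λ)`. -/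
def HL {α : Type*} [MeasurableSpace α] (μ : Measure α) (lam : ℝ) (d d' : α → α → ℝ) : ℝ :=
  sInf {ε : ℝ | 0 < ε ∧ (∀ f ∈ Lip1 d, ∃ g ∈ Lip1 d', meDist μ lam f g ≤ ε) ∧
    (∀ g ∈ Lip1 d', ∃ f ∈ Lip1 d, meDist μ lam f g ≤ ε)}

/-- `inf H_λLι₁(φX*d_X, φY*d_Y)` over all parameters, for mm-spaces of equal total mass `m`. -/
def obsInf {X Y : Type*} [PseudoMetricSpace X] [MeasurableSpace X]
    [PseudoMetricSpace Y] [MeasurableSpace Y] (lam m : ℝ)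
    (μX : Measure X) (μY : Measure Y) : ℝ :=
  sInf {r : ℝ | ∃ (φX : ℝ → X) (φY : ℝ → Y), IsParameter μX m φX ∧ IsParameter μY m φY ∧
    r = HL (lebIcc m) lam (pb φX) (pb φY)}

open Classical in
/-- Gromov's observable distance `H̲_λLι₁(X, Y)` between mm-spaces. -/
def mmObs {X Y : Type*} [PseudoMetricSpace X] [MeasurableSpace X]
    [PseudoMetricSpace Y] [MeasurableSpace Y] (lam : ℝ)
    (μX : Measure X) (μY : Measure Y) : ℝ :=
  if (μX univ).toReal = (μY univ).toReal then
    obsInf lam (μX univ).toReal μX μY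
  else if (μX univ).toReal < (μY univ).toReal then
    obsInf lam (μX univ).toReal μX
      ((ENNReal.ofReal ((μX univ).toReal / (μY univ).toReal)) • μY)
      + ((μY univ).toReal - (μX univ).toReal)
  else
    obsInf lam (μY univ).toReal
      ((ENNReal.ofReal ((μY univ).toReal / (μX univ).toReal)) • μX) μY
      + ((μX univ).toReal - (μY univ).toReal)

/-- `f : X → Y` is `λ`-Lipschitz up to `ε`. -/
def LipUpTo {X Y : Type*} [PseudoMetricSpace X] [PseudoMetricSpace Y] [MeasurableSpace X]
    (μX : Measure X) (lam ε : ℝ) (f : X → Y) : Prop :=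
  ∃ X₀ : Set X, MeasurableSet X₀ ∧ (μX X₀ᶜ).toReal ≤ ε ∧
    ∀ x ∈ X₀, ∀ x' ∈ X₀, dist (f x) (f x') ≤ lam * dist x x' + ε

/-- Weak convergence of a sequence of finite Borel measures: convergence of integrals of
all bounded continuous functions. -/
def WeakConv {Y : Type*} [TopologicalSpace Y] [MeasurableSpace Y]
    (μs : ℕ → Measure Y) (μ : Measure Y) : Prop :=
  ∀ g : BoundedContinuousFunction Y ℝ,
    Tendsto (fun n => ∫ y, g y ∂(μs n)) atTop (𝓝 (∫ y, g y ∂μ))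

/-- `X` Lipschitz dominates `Y`: there are a `1`-Lipschitz map `p : Supp μX → Supp μY` and
`c ≥ 1` with `p_*(μX) = c • μY`. -/
def LipDom {X Y : Type*} [MetricSpace X] [MeasurableSpace X] [MetricSpace Y] [MeasurableSpace Y]
    (μX : Measure X) (μY : Measure Y) : Prop :=
  ∃ (p : msupport μX → msupport μY) (c : ℝ), 1 ≤ c ∧
    (∀ a b : msupport μX, dist (p a) (p b) ≤ dist a b) ∧
    Measure.map p (Measure.comap Subtype.val μX)
      = (ENNReal.ofReal c) • Measure.comap Subtype.val μY

end

lemma IsSemiDist.lip1 {α : Type*} {d : α → α → ℝ} (hd : IsSemiDist d) (x : α) : d x ∈ Lip1 d := by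
  intro y z
  have h1 := hd.triangle x y z
  have h2 := hd.triangle x z y
  rw [hd.symm z y] at h2
  rw [abs_le]
  constructor <;> linarith

lemma IsSemiDist.nonneg {α : Type*} {d : α → α → ℝ} (hd : IsSemiDist d) (x y : α) : 0 ≤ d x y := by
  have h1 := hd.triangle x y x
  rw [hd.symm y x, hd.refl] at h1
  linarith

section Aux

variable {α : Type*} [MeasurableSpace α] {μ : Measure α} {d d' : α → α → ℝ} {f g : α → ℝ} {ε : ℝ}

/-- `d` is bounded on a set of full measure. -/
def EssBdd {α : Type*} [MeasurableSpace α] (μ : Measure α) (d : α → α → ℝ) : Prop :=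
  ∃ C : ℝ, ∃ T ∈ ae μ, ∀ x ∈ T, ∀ y ∈ T, d x y ≤ C

lemma isSemiDist_pb {X : Type*} [PseudoMetricSpace X] (φ : ℝ → X) : IsSemiDist (pb φ) :=
  ⟨fun _ => dist_self _, fun _ _ => dist_comm _ _, fun _ _ _ => dist_triangle _ _ _⟩

lemma meDist_comm (μ : Measure α) (lam : ℝ) (f g : α → ℝ) :
    meDist μ lam f g = meDist μ lam g f := by
  simp only [meDist, abs_sub_comm]

lemma HL_nonneg (μ : Measure α) (lam : ℝ) (d d' : α → α → ℝ) : 0 ≤ HL μ lam d d' :=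
  Real.sInf_nonneg fun _ h => h.1.le

lemma boxDist_nonneg (μ : Measure α) (lam : ℝ) (d d' : α → α → ℝ) : 0 ≤ boxDist μ lam d d' :=
  Real.sInf_nonneg fun _ h => h.1.le

lemma meDist_zero_set [IsFiniteMeasure μ] (f g : α → ℝ) :
    {ε : ℝ | 0 < ε ∧ (μ {x | ε ≤ |f x - g x|}).toReal ≤ 0 * ε} =
      {ε : ℝ | 0 < ε ∧ ∀ᵐ x ∂μ, |f x - g x| < ε} := by
  ext ε
  simp only [mem_ofPred_eq, zero_mul, and_congr_right_iff]
  intro _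
  rw [ae_iff]
  simp only [not_lt]
  constructor
  · intro h
    have h0 := le_antisymm h ENNReal.toReal_nonneg
    exact ((ENNReal.toReal_eq_zero_iff _).1 h0).resolve_right (measure_ne_top _ _)
  · intro h
    rw [h]; simp

lemma meDist_le_of_ae [IsFiniteMeasure μ] (hε : 0 ≤ ε) (h : ∀ᵐ x ∂μ, |f x - g x| ≤ ε) :
    meDist μ 0 f g ≤ ε := by
  unfold meDist
  rw [meDist_zero_set]
  refine le_of_forall_pos_le_add fun δ hδ => csInf_le ⟨0, fun _ h => h.1.le⟩ ⟨by linarith, ?_⟩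
  filter_upwards [h] with x hx
  linarith

lemma ae_le_of_meDist_le [IsFiniteMeasure μ] {C : ℝ} (hC : ∀ᵐ x ∂μ, |f x - g x| ≤ C)
    (h : meDist μ 0 f g ≤ ε) : ∀ᵐ x ∂μ, |f x - g x| ≤ ε := by
  unfold meDist at h
  rw [meDist_zero_set] at h
  have hne : {ε : ℝ | 0 < ε ∧ ∀ᵐ x ∂μ, |f x - g x| < ε}.Nonempty := by
    refine ⟨|C| + 1, by positivity, ?_⟩
    filter_upwards [hC] with x hx
    linarith [le_abs_self C]
  have key : ∀ n : ℕ, ∀ᵐ x ∂μ, |f x - g x| ≤ ε + 1 / ((n : ℝ) + 1) := by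
    intro n
    have hn : (0 : ℝ) < 1 / ((n : ℝ) + 1) := by positivity
    obtain ⟨e, he, hlt⟩ := exists_lt_of_csInf_lt hne
      (lt_of_le_of_lt h (lt_add_of_pos_right ε hn))
    filter_upwards [he.2] with x hx
    linarith
  filter_upwards [ae_all_iff.2 key] with x hx
  refine le_of_forall_pos_le_add fun δ hδ => ?_
  obtain ⟨n, hn⟩ := exists_nat_one_div_lt hδ
  linarith [hx n]

lemma meDist_eq_zero_of_not_bdd [IsFiniteMeasure μ]
    (h : ¬ ∃ C, ∀ᵐ x ∂μ, |f x - g x| ≤ C) : meDist μ 0 f g = 0 := by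
  unfold meDist
  rw [meDist_zero_set]
  convert Real.sInf_empty
  rw [eq_empty_iff_forall_notMem]
  rintro ε ⟨-, hε⟩
  exact h ⟨ε, hε.mono fun x hx => hx.le⟩

lemma EssBdd.lip1_bdd (hd : EssBdd μ d) (hf : f ∈ Lip1 d) : ∃ C, ∀ᵐ x ∂μ, |f x| ≤ C := by
  obtain ⟨C, T, hT, h⟩ := hd
  rcases T.eq_empty_or_nonempty with rfl | ⟨t, ht⟩
  · exact ⟨0, mem_of_superset hT (empty_subset _)⟩
  · refine ⟨C + |f t|, mem_of_superset hT fun x hx => ?_⟩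
    have h1 := (hf x t).trans (h x hx t ht)
    have h2 := abs_sub_abs_le_abs_sub (f x) (f t)
    show |f x| ≤ _
    linarith

lemma bdd_sub {C C' : ℝ} (hf : ∀ᵐ x ∂μ, |f x| ≤ C) (hg : ∀ᵐ x ∂μ, |g x| ≤ C') :
    ∀ᵐ x ∂μ, |f x - g x| ≤ C + C' := by
  filter_upwards [hf, hg] with x h1 h2
  exact (abs_sub _ _).trans (add_le_add h1 h2)

lemma EssBdd.of_lip1_bdd (hd : IsSemiDist d) {t : α} {C : ℝ} (h : ∀ᵐ x ∂μ, |d t x| ≤ C) :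
    EssBdd μ d := by
  refine ⟨C + C, _, h, fun x hx y hy => ?_⟩
  have h1 : |d t x| ≤ C := hx
  have h2 : |d t y| ≤ C := hy
  have := hd.triangle x t y
  rw [hd.symm x t] at this
  linarith [le_abs_self (d t x), le_abs_self (d t y)]

lemma EssBdd.of_isEmpty [IsEmpty α] : EssBdd μ d := ⟨0, univ, univ_mem, fun x => isEmptyElim x⟩

lemma boxDist_zero_set [IsFiniteMeasure μ] (d d' : α → α → ℝ) :
    {ε : ℝ | 0 < ε ∧ ∃ T : Set α, MeasurableSet T ∧
      (μ univ).toReal - 0 * ε ≤ (μ T).toReal ∧ ∀ x ∈ T, ∀ y ∈ T, |d x y - d' x y| ≤ ε} =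
    {ε : ℝ | 0 < ε ∧ ∃ T ∈ ae μ, ∀ x ∈ T, ∀ y ∈ T, |d x y - d' x y| ≤ ε} := by
  ext ε
  simp only [mem_ofPred_eq, zero_mul, sub_zero, and_congr_right_iff]
  intro _
  constructor
  · rintro ⟨T, hT, hm, h⟩
    refine ⟨T, ?_, h⟩
    have h1 : μ univ ≤ μ T := (ENNReal.toReal_le_toReal (measure_ne_top _ _)
      (measure_ne_top _ _)).1 hm
    rw [mem_ae_iff, measure_compl hT (measure_ne_top _ _)]
    exact tsub_eq_zero_of_le h1
  · rintro ⟨T, hT, h⟩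
    have hs : (toMeasurable μ Tᶜ)ᶜ ⊆ T := compl_subset_comm.1 (subset_toMeasurable μ _)
    have h0 : (toMeasurable μ Tᶜ)ᶜ ∈ ae μ := by
      rw [mem_ae_iff, compl_compl, measure_toMeasurable]; exact hT
    refine ⟨_, (measurableSet_toMeasurable _ _).compl, ?_, fun x hx y hy => h x (hs hx) y (hs hy)⟩
    rw [measure_congr (eventuallyEq_univ.2 h0)]

/-- A `1`-Lipschitz function for `d` is uniformly close on `T` to one for `d'`, by the
McShane extension formula. -/
lemma exists_lip1_near [IsFiniteMeasure μ] (hd' : IsSemiDist d') (hε : 0 < ε) {T : Set α}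
    (hT : T ∈ ae μ) (h : ∀ x ∈ T, ∀ y ∈ T, |d x y - d' x y| ≤ ε) (hf : f ∈ Lip1 d) :
    ∃ g ∈ Lip1 d', meDist μ 0 f g ≤ ε := by
  rcases T.eq_empty_or_nonempty with rfl | ⟨t, ht⟩
  · refine ⟨0, fun x y => by simpa using hd'.nonneg x y, meDist_le_of_ae hε.le ?_⟩
    exact mem_of_superset hT (empty_subset _)
  have hfT : ∀ x ∈ T, ∀ y ∈ T, f x - ε ≤ f y + d' x y := by
    intro x hx y hy
    have h1 := (le_abs_self _).trans (hf x y)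
    have h2 := (le_abs_self _).trans (h x hx y hy)
    linarith
  have hbdd : ∀ x, BddBelow (range fun y : T => f y + d' x y) := by
    intro x
    refine ⟨f t - ε - d' t x, ?_⟩
    rintro _ ⟨y, rfl⟩
    have h1 := hfT t ht y y.2
    have h2 := hd'.triangle t x y
    simp only
    linarith
  have : Nonempty T := ⟨⟨t, ht⟩⟩
  have hle : ∀ x z, (⨅ y : T, f y + d' x y) ≤ (⨅ y : T, f y + d' z y) + d' x z := by
    intro x z
    rw [← sub_le_iff_le_add]
    refine le_ciInf fun y => ?_
    have h1 := ciInf_le (hbdd x) y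
    have h2 := hd'.triangle x z y
    linarith
  refine ⟨fun x => ⨅ y : T, f y + d' x y, ?_, meDist_le_of_ae hε.le ?_⟩
  · intro x z
    have h1 := hle x z
    have h2 := hle z x
    rw [hd'.symm z x] at h2
    rw [abs_le]
    constructor <;> linarith
  · refine mem_of_superset hT fun x hx => ?_
    have h1 := ciInf_le (hbdd x) ⟨x, hx⟩
    have h2 : f x - ε ≤ ⨅ y : T, f y + d' x y := le_ciInf fun y => hfT x hx y y.2
    simp only [hd'.refl, add_zero] at h1
    show |f x - ⨅ y : T, f y + d' x y| ≤ ε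
    rw [abs_le]
    constructor <;> linarith

lemma HL_set_of_boxDist_set [IsFiniteMeasure μ] (hd : IsSemiDist d) (hd' : IsSemiDist d')
    (hε : 0 < ε) {T : Set α} (hT : T ∈ ae μ) (h : ∀ x ∈ T, ∀ y ∈ T, |d x y - d' x y| ≤ ε) :
    (∀ f ∈ Lip1 d, ∃ g ∈ Lip1 d', meDist μ 0 f g ≤ ε) ∧
    (∀ g ∈ Lip1 d', ∃ f ∈ Lip1 d, meDist μ 0 f g ≤ ε) := by
  refine ⟨fun f hf => exists_lip1_near hd' hε hT h hf, fun g hg => ?_⟩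
  obtain ⟨f, hf, hfg⟩ := exists_lip1_near (f := g) hd hε hT
    (fun x hx y hy => by rw [abs_sub_comm]; exact h x hx y hy) hg
  exact ⟨f, hf, by rwa [meDist_comm]⟩

lemma boxDist_set_nonempty (hd : IsSemiDist d) (hd' : IsSemiDist d') (hb : EssBdd μ d)
    (hb' : EssBdd μ d') :
    {ε : ℝ | 0 < ε ∧ ∃ T ∈ ae μ, ∀ x ∈ T, ∀ y ∈ T, |d x y - d' x y| ≤ ε}.Nonempty := by
  obtain ⟨C, T, hT, h⟩ := hb
  obtain ⟨C', T', hT', h'⟩ := hb'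
  refine ⟨|C| + |C'| + 1, by positivity, T ∩ T', inter_mem hT hT', fun x hx y hy => ?_⟩
  have h1 := h x hx.1 y hy.1
  have h2 := h' x hx.2 y hy.2
  have h3 := hd.nonneg x y
  have h4 := hd'.nonneg x y
  rw [abs_le]
  constructor <;> linarith [le_abs_self C, le_abs_self C', abs_nonneg C, abs_nonneg C']

lemma HL_le_boxDist [IsFiniteMeasure μ] (hd : IsSemiDist d) (hd' : IsSemiDist d')
    (hb : EssBdd μ d) (hb' : EssBdd μ d') : HL μ 0 d d' ≤ boxDist μ 0 d d' := by
  unfold boxDist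
  rw [boxDist_zero_set]
  refine le_csInf (boxDist_set_nonempty hd hd' hb hb') ?_
  rintro ε ⟨hε, T, hT, h⟩
  exact csInf_le ⟨0, fun _ h => h.1.le⟩ ⟨hε, HL_set_of_boxDist_set hd hd' hε hT h⟩

lemma exists_lip1_meDist_nonpos [IsFiniteMeasure μ] (hd' : IsSemiDist d') (hb' : ¬ EssBdd μ d')
    (f : α → ℝ) : ∃ g ∈ Lip1 d', meDist μ 0 f g ≤ 0 := by
  by_cases hf : ∃ C, ∀ᵐ x ∂μ, |f x| ≤ C
  · obtain ⟨C, hC⟩ := hf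
    obtain ⟨t⟩ : Nonempty α := by
      by_contra h
      rw [not_nonempty_iff] at h
      exact hb' EssBdd.of_isEmpty
    refine ⟨d' t, hd'.lip1 t, (meDist_eq_zero_of_not_bdd ?_).le⟩
    rintro ⟨D, hD⟩
    refine hb' (EssBdd.of_lip1_bdd hd' (t := t) (C := D + C) ?_)
    filter_upwards [hC, hD] with x h1 h2
    rw [abs_le] at *
    constructor <;> linarith
  · refine ⟨0, fun x y => by simpa using hd'.nonneg x y, (meDist_eq_zero_of_not_bdd ?_).le⟩
    simpa using hf

lemma EssBdd.of_HL_set [IsFiniteMeasure μ] (hd : IsSemiDist d) (hb' : EssBdd μ d')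
    (h : ∀ f ∈ Lip1 d, ∃ g ∈ Lip1 d', meDist μ 0 f g ≤ ε) : EssBdd μ d := by
  rcases isEmpty_or_nonempty α with _ | ⟨⟨t⟩⟩
  · exact EssBdd.of_isEmpty
  obtain ⟨C, T, hT, hTC⟩ := id hb'
  have key : ∀ n : ℕ, ∃ S ∈ ae μ, ∀ x ∈ S, ∀ y ∈ S, min (d t x) n ≤ min (d t y) n + (2 * ε + C) := by
    intro n
    have hlip : (fun x => min (d t x) (n : ℝ)) ∈ Lip1 d := fun x y =>
      (abs_min_sub_min_le_max _ _ _ _).trans (by simpa using hd.lip1 t x y)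
    obtain ⟨g, hg, hfg⟩ := h _ hlip
    obtain ⟨D, hD⟩ := hb'.lip1_bdd hg
    have hn : ∀ᵐ x ∂μ, |min (d t x) (n : ℝ)| ≤ n := Eventually.of_forall fun x => by
      rw [abs_of_nonneg (le_min (hd.nonneg _ _) (Nat.cast_nonneg n))]
      exact min_le_right _ _
    have hae := ae_le_of_meDist_le (bdd_sub hn hD) hfg
    refine ⟨_, inter_mem hT hae, fun x hx y hy => ?_⟩
    have h1 := abs_le.1 (show |min (d t x) (n : ℝ) - g x| ≤ ε from hx.2)
    have h2 := abs_le.1 (show |min (d t y) (n : ℝ) - g y| ≤ ε from hy.2)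
    have h3 := (le_abs_self _).trans ((hg x y).trans (hTC x hx.1 y hy.1))
    linarith [h1.2, h2.1]
  choose S hS hSn using key
  have hI : (⋂ n, S n) ∈ ae μ := countable_iInter_mem.2 hS
  rcases (⋂ n, S n).eq_empty_or_nonempty with he | ⟨s, hs⟩
  · exact ⟨0, _, hI, by simp [he]⟩
  refine EssBdd.of_lip1_bdd hd (t := t) (C := d t s + (2 * ε + C))
    (mem_of_superset hI fun x hx => ?_)
  obtain ⟨n, hn⟩ := exists_nat_ge (d t x)
  have h1 := hSn n x (mem_iInter.1 hx n) s (mem_iInter.1 hs n)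
  rw [min_eq_left hn] at h1
  show |d t x| ≤ _
  rw [abs_of_nonneg (hd.nonneg _ _)]
  linarith [min_le_left (d t s) (n : ℝ)]

lemma HL_nonpos_of_not_essBdd [IsFiniteMeasure μ] (hd : IsSemiDist d) (hd' : IsSemiDist d')
    (h : ¬ (EssBdd μ d ∧ EssBdd μ d')) : HL μ 0 d d' ≤ 0 := by
  by_cases h0 : ¬ EssBdd μ d ∧ ¬ EssBdd μ d'
  · refine le_of_forall_pos_le_add fun ε hε => csInf_le ⟨0, fun _ h => h.1.le⟩ ?_
    rw [zero_add]
    refine ⟨hε, fun f _ => ?_, fun g _ => ?_⟩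
    · obtain ⟨g, hg, hfg⟩ := exists_lip1_meDist_nonpos hd' h0.2 f
      exact ⟨g, hg, hfg.trans hε.le⟩
    · obtain ⟨f, hf, hfg⟩ := exists_lip1_meDist_nonpos hd h0.1 g
      exact ⟨f, hf, by rw [meDist_comm]; exact hfg.trans hε.le⟩
  · refine le_of_eq ?_
    unfold HL
    convert Real.sInf_empty
    rw [eq_empty_iff_forall_notMem]
    rintro ε ⟨-, h1, h2⟩
    by_cases hb : EssBdd μ d
    · refine h ⟨hb, EssBdd.of_HL_set hd' hb (ε := ε) fun g hg => ?_⟩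
      obtain ⟨f, hf, hfg⟩ := h2 g hg
      exact ⟨f, hf, by rwa [meDist_comm]⟩
    · have hb' : EssBdd μ d' := by tauto
      exact hb (EssBdd.of_HL_set hd hb' h1)

end Aux

instance (m : ℝ) : IsFiniteMeasure (lebIcc m) := by
  unfold lebIcc; infer_instance

lemma EssBdd.pullback {X : Type*} [PseudoMetricSpace X] [MeasurableSpace X] {φX : ℝ → X} {m : ℝ}
    {μX : Measure X} (hX : IsParameter μX m φX)
    (h : EssBdd μX fun x y => dist x y) : EssBdd (lebIcc m) (pb φX) := by
  obtain ⟨C, T, hT, h⟩ := h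
  rw [← hX.2] at hT
  exact ⟨C, φX ⁻¹' T, (hX.1.quasiMeasurePreserving _).ae hT,
    fun x hx y hy => h _ hx _ hy⟩

lemma exists_mem_of_pos {α : Type*} [MeasurableSpace α] {μ : Measure α} {A T : Set α}
    (hT : T ∈ ae μ) (hA : μ A ≠ 0) :
    ∃ s ∈ T, s ∈ A := by
  by_contra! hcon
  exact hA (measure_mono_null (fun s hs hsT => hcon s hsT hs) hT)

section Params

variable {X Y : Type*} [MetricSpace X] [SecondCountableTopology X]
  [MeasurableSpace X] [BorelSpace X] [MetricSpace Y] [SecondCountableTopology Y]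
  [MeasurableSpace Y] [BorelSpace Y] {φX : ℝ → X} {φY : ℝ → Y} {m : ℝ}

lemma lip1_near_on_support {μ : Measure ℝ} {f g : ℝ → ℝ} {ε : ℝ}
    (hX : Measurable φX) (hY : Measurable φY) (hf : f ∈ Lip1 (pb φX)) (hg : g ∈ Lip1 (pb φY))
    (h : ∀ᵐ x ∂μ, |f x - g x| ≤ ε) {t : ℝ}
    (ht : (φX t, φY t) ∈ (μ.map fun s => (φX s, φY s)).support) : |f t - g t| ≤ ε := by
  refine le_of_forall_pos_le_add fun δ hδ => ?_
  have hpos := (Measure.mem_support_iff_forall _).1 ht _ (Metric.ball_mem_nhds _ (half_pos hδ))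
  rw [Measure.map_apply (hX.prodMk hY) Metric.isOpen_ball.measurableSet] at hpos
  obtain ⟨s, hs, hsf⟩ : ∃ s, s ∈ (fun s => (φX s, φY s)) ⁻¹' Metric.ball (φX t, φY t) (δ / 2) ∧
      |f s - g s| ≤ ε := by
    by_contra! hcon
    refine hpos.ne' (measure_mono_null ?_ (ae_iff.1 h))
    intro s hs
    exact not_le.2 (hcon s hs)
  have hs' : dist (φX s) (φX t) < δ / 2 ∧ dist (φY s) (φY t) < δ / 2 := by
    simpa [Prod.dist_eq] using hs
  have h1 := abs_le.1 (hf s t)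
  have h2 := abs_le.1 (hg s t)
  have h3 := abs_le.1 hsf
  simp only [pb] at h1 h2
  rw [abs_le]
  constructor <;> linarith [hs'.1, hs'.2, h1.1, h1.2, h2.1, h2.2, h3.1, h3.2]

lemma boxDist_le_two_HL {μ : Measure ℝ} [IsFiniteMeasure μ] (hX : Measurable φX)
    (hY : Measurable φY) (hb : EssBdd μ (pb φX)) (hb' : EssBdd μ (pb φY)) :
    boxDist μ 0 (pb φX) (pb φY) ≤ 2 * HL μ 0 (pb φX) (pb φY) := by
  have hd := isSemiDist_pb φX
  have hd' := isSemiDist_pb φY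
  have hne : {ε : ℝ | 0 < ε ∧
      (∀ f ∈ Lip1 (pb φX), ∃ g ∈ Lip1 (pb φY), meDist μ 0 f g ≤ ε) ∧
      (∀ g ∈ Lip1 (pb φY), ∃ f ∈ Lip1 (pb φX), meDist μ 0 f g ≤ ε)}.Nonempty := by
    obtain ⟨ε, hε, T, hT, h⟩ := boxDist_set_nonempty hd hd' hb hb'
    exact ⟨ε, hε, HL_set_of_boxDist_set hd hd' hε hT h⟩
  suffices boxDist μ 0 (pb φX) (pb φY) / 2 ≤ HL μ 0 (pb φX) (pb φY) by linarith
  refine le_csInf hne ?_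
  rintro ε ⟨hε, h1, h2⟩
  rw [div_le_iff₀ two_pos]
  unfold boxDist
  rw [boxDist_zero_set]
  refine csInf_le ⟨0, fun _ h => h.1.le⟩ ⟨by positivity,
    (fun s => (φX s, φY s)) ⁻¹' (μ.map fun s => (φX s, φY s)).support, ?_, ?_⟩
  · exact (hX.prodMk hY).quasiMeasurePreserving μ |>.ae Measure.support_mem_ae
  intro x hx y hy
  rw [abs_le]
  constructor
  · obtain ⟨f, hf, hfg⟩ := h2 _ (hd'.lip1 x)
    obtain ⟨C, hC⟩ := hb.lip1_bdd hf
    obtain ⟨C', hC'⟩ := hb'.lip1_bdd (hd'.lip1 x)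
    have hae := ae_le_of_meDist_le (bdd_sub hC hC') hfg
    have e1 := abs_le.1 (lip1_near_on_support hX hY hf (hd'.lip1 x) hae hx)
    have e2 := abs_le.1 (lip1_near_on_support hX hY hf (hd'.lip1 x) hae hy)
    rw [hd'.refl] at e1
    have e3 := abs_le.1 (hf x y)
    linarith [e1.1, e1.2, e2.1, e2.2, e3.1, e3.2]
  · obtain ⟨g, hg, hfg⟩ := h1 _ (hd.lip1 x)
    obtain ⟨C, hC⟩ := hb.lip1_bdd (hd.lip1 x)
    obtain ⟨C', hC'⟩ := hb'.lip1_bdd hg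
    have hae := ae_le_of_meDist_le (bdd_sub hC hC') hfg
    have e1 := abs_le.1 (lip1_near_on_support hX hY (hd.lip1 x) hg hae hx)
    have e2 := abs_le.1 (lip1_near_on_support hX hY (hd.lip1 x) hg hae hy)
    rw [hd.refl] at e1
    have e3 := abs_le.1 (hg x y)
    linarith [e1.1, e1.2, e2.1, e2.2, e3.1, e3.2]

lemma EssBdd.of_pullback {μX : Measure X} (hX : IsParameter μX m φX)
    (h : EssBdd (lebIcc m) (pb φX)) : EssBdd μX fun x y => dist x y := by
  obtain ⟨C, T, hT, h⟩ := h
  refine ⟨C + 2, μX.support, Measure.support_mem_ae, fun x hx y hy => ?_⟩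
  have key : ∀ x ∈ μX.support, ∃ s ∈ T, dist (φX s) x < 1 := by
    intro x hx
    have hpos := (Measure.mem_support_iff_forall _).1 hx _ (Metric.ball_mem_nhds _ one_pos)
    rw [← hX.2, Measure.map_apply hX.1 Metric.isOpen_ball.measurableSet] at hpos
    exact exists_mem_of_pos hT hpos.ne'
  obtain ⟨s, hs, hsx⟩ := key x hx
  obtain ⟨t, ht, hty⟩ := key y hy
  have h1 := h s hs t ht
  simp only [pb] at h1
  have h2 := dist_triangle4 x (φX s) (φX t) y
  rw [dist_comm x (φX s)] at h2
  simp only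
  linarith

/-- If the pulled back distances are uniformly close on a set of full measure, under parameters
for which products of non-null sets are non-null, then `X` is essentially bounded. -/
lemma EssBdd.of_boxDist_set {μX : Measure X} {μY : Measure Y} {ε : ℝ} (hY0 : μY ≠ 0)
    (hprod : ∀ (A : Set X) (B : Set Y), MeasurableSet A → MeasurableSet B → μX A ≠ 0 → μY B ≠ 0 →
      lebIcc m (φX ⁻¹' A ∩ φY ⁻¹' B) ≠ 0) {T : Set ℝ} (hT : T ∈ ae (lebIcc m))
    (h : ∀ x ∈ T, ∀ y ∈ T, |pb φX x y - pb φY x y| ≤ ε) :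
    EssBdd μX fun x y => dist x y := by
  obtain ⟨y₀, hy₀⟩ := Measure.nonempty_support hY0
  refine ⟨ε + 4, μX.support, Measure.support_mem_ae, fun x hx y hy => ?_⟩
  have key : ∀ x ∈ μX.support, ∃ s ∈ T, dist (φX s) x < 1 ∧ dist (φY s) y₀ < 1 := by
    intro x hx
    have hpos := (Measure.mem_support_iff_forall _).1 hx _ (Metric.ball_mem_nhds _ one_pos)
    have hpos' := (Measure.mem_support_iff_forall _).1 hy₀ _ (Metric.ball_mem_nhds _ one_pos)
    exact exists_mem_of_pos hT (hprod _ _ Metric.isOpen_ball.measurableSet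
      Metric.isOpen_ball.measurableSet hpos.ne' hpos'.ne')
  obtain ⟨s, hs, hsx, hsy⟩ := key x hx
  obtain ⟨t, ht, htx, hty⟩ := key y hy
  have h1 := (abs_le.1 (h s hs t ht)).2
  simp only [pb] at h1
  have h2 := dist_triangle4 x (φX s) (φX t) y
  have h3 := dist_triangle_right (φY s) (φY t) y₀
  rw [dist_comm x (φX s)] at h2
  simp only
  linarith

end Params

lemma map_projIcc_lebIcc {m : ℝ} (hm : 0 < m) :
    (lebIcc m).map (fun t => projIcc (0 : ℝ) 1 zero_le_one (t * m⁻¹)) =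
      ENNReal.ofReal m • (volume : Measure unitInterval) := by
  have hmeas : Measurable fun t : ℝ => projIcc (0 : ℝ) 1 zero_le_one (t * m⁻¹) :=
    (continuous_projIcc.comp (continuous_mul_const _)).measurable
  ext s hs
  rw [Measure.map_apply hmeas hs, lebIcc, Measure.restrict_apply (hmeas hs), Measure.smul_apply,
    unitInterval.volume_apply, smul_eq_mul]
  have hset : (fun t : ℝ => projIcc (0 : ℝ) 1 zero_le_one (t * m⁻¹)) ⁻¹' s ∩ Icc 0 m =
      (fun t => t * m⁻¹) ⁻¹' (Subtype.val '' s) := by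
    ext t
    have hiff : t ∈ Icc 0 m ↔ t * m⁻¹ ∈ Icc (0 : ℝ) 1 := by
      rw [← div_eq_mul_inv, mem_Icc, mem_Icc, div_le_one hm, le_div_iff₀ hm, zero_mul]
    simp only [mem_inter_iff, mem_preimage, mem_image]
    constructor
    · rintro ⟨h1, h2⟩
      refine ⟨_, h1, ?_⟩
      rw [projIcc_of_mem _ (hiff.1 h2)]
    · rintro ⟨u, hu, hut⟩
      have h2 : t * m⁻¹ ∈ Icc (0 : ℝ) 1 := hut ▸ u.2
      refine ⟨?_, hiff.2 h2⟩
      rw [projIcc_of_mem _ h2]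
      convert hu
      exact hut.symm
  rw [hset, Real.volume_preimage_mul_right (inv_ne_zero hm.ne'), inv_inv, abs_of_pos hm]

/-- Every nonzero finite measure on a standard Borel space is the image of Lebesgue measure. -/
lemma exists_isParameter {Z : Type*} [MeasurableSpace Z] [StandardBorelSpace Z]
    (ν : Measure Z) [IsFiniteMeasure ν] (hν : ν ≠ 0) :
    ∃ φ : ℝ → Z, IsParameter ν (ν univ).toReal φ := by
  have : NeZero ν := ⟨hν⟩
  have : Nonempty Z := ν.nonempty_of_neZero
  obtain ⟨f, hf, hmap⟩ := Measure.exists_measurable_map_eq ((ν univ)⁻¹ • ν)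
  have hm : 0 < (ν univ).toReal := ENNReal.toReal_pos (NeZero.ne _) (measure_ne_top _ _)
  have hmeas : Measurable fun t : ℝ => projIcc (0 : ℝ) 1 zero_le_one (t * (ν univ).toReal⁻¹) :=
    (continuous_projIcc.comp (continuous_mul_const _)).measurable
  refine ⟨_, hf.comp hmeas, ?_⟩
  rw [← Measure.map_map hf hmeas, map_projIcc_lebIcc hm, Measure.map_smul, hmap, smul_smul,
    ENNReal.ofReal_toReal (measure_ne_top _ _),
    ENNReal.mul_inv_cancel (NeZero.ne _) (measure_ne_top _ _), one_smul]

lemma exists_product_parameters {X Y : Type*} [MeasurableSpace X] [StandardBorelSpace X]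
    [MeasurableSpace Y] [StandardBorelSpace Y] (μX : Measure X) (μY : Measure Y)
    [IsFiniteMeasure μX] [IsFiniteMeasure μY] (hm : μX univ = μY univ) (h0 : μX ≠ 0) :
    ∃ (φX : ℝ → X) (φY : ℝ → Y), IsParameter μX (μX univ).toReal φX ∧
      IsParameter μY (μX univ).toReal φY ∧
      ∀ (A : Set X) (B : Set Y), MeasurableSet A → MeasurableSet B → μX A ≠ 0 → μY B ≠ 0 →
        lebIcc (μX univ).toReal (φX ⁻¹' A ∩ φY ⁻¹' B) ≠ 0 := by
  have hu : μX univ ≠ 0 := by simpa using h0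
  have ht : μX univ ≠ ⊤ := measure_ne_top _ _
  set c := (μX univ)⁻¹ with hc
  have hc0 : c ≠ 0 := ENNReal.inv_ne_zero.2 ht
  have hct : c ≠ ⊤ := ENNReal.inv_ne_top.2 hu
  have hmul : c * μX univ = 1 := ENNReal.inv_mul_cancel hu ht
  set ν := c • μX.prod μY with hν
  have : IsFiniteMeasure ν := Measure.smul_finite _ hct
  have hνu : ν univ = μX univ := by
    rw [hν, Measure.smul_apply, ← univ_prod_univ, Measure.prod_prod, smul_eq_mul, ← mul_assoc, hmul,
      one_mul, hm]
  obtain ⟨φ, hφ, hφm⟩ := exists_isParameter ν (by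
    intro h
    rw [h] at hνu
    exact hu (by simpa using hνu.symm))
  rw [hνu] at hφm
  refine ⟨fun t => (φ t).1, fun t => (φ t).2, ⟨hφ.fst, ?_⟩, ⟨hφ.snd, ?_⟩, ?_⟩
  · rw [show (fun t => (φ t).1) = Prod.fst ∘ φ from rfl, ← Measure.map_map measurable_fst hφ, hφm,
      hν, Measure.map_smul, Measure.map_fst_prod, smul_smul, ← hm, hmul, one_smul]
  · rw [show (fun t => (φ t).2) = Prod.snd ∘ φ from rfl, ← Measure.map_map measurable_snd hφ, hφm,
      hν, Measure.map_smul, Measure.map_snd_prod, smul_smul, hmul, one_smul]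
  · intro A B hA hB hA0 hB0
    have : (fun t => (φ t).1) ⁻¹' A ∩ (fun t => (φ t).2) ⁻¹' B = φ ⁻¹' (A ×ˢ B) := rfl
    rw [this, ← Measure.map_apply hφ (hA.prod hB), hφm, hν, Measure.smul_apply, Measure.prod_prod,
      smul_eq_mul]
    exact mul_ne_zero hc0 (mul_ne_zero hA0 hB0)

section Infima

variable {X Y : Type*} [PseudoMetricSpace X] [MeasurableSpace X] [PseudoMetricSpace Y]
  [MeasurableSpace Y]

lemma obsInf_nonneg (lam m : ℝ) (μX : Measure X) (μY : Measure Y) : 0 ≤ obsInf lam m μX μY :=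
  Real.sInf_nonneg (by rintro _ ⟨_, _, _, _, rfl⟩; exact HL_nonneg _ _ _ _)

lemma boxInf_nonneg (lam m : ℝ) (μX : Measure X) (μY : Measure Y) : 0 ≤ boxInf lam m μX μY :=
  Real.sInf_nonneg (by rintro _ ⟨_, _, _, _, rfl⟩; exact boxDist_nonneg _ _ _ _)

lemma obsInf_le {lam m : ℝ} {μX : Measure X} {μY : Measure Y} {φX : ℝ → X} {φY : ℝ → Y}
    (hX : IsParameter μX m φX) (hY : IsParameter μY m φY) :
    obsInf lam m μX μY ≤ HL (lebIcc m) lam (pb φX) (pb φY) :=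
  csInf_le ⟨0, by rintro _ ⟨_, _, _, _, rfl⟩; exact HL_nonneg _ _ _ _⟩ ⟨_, _, hX, hY, rfl⟩

lemma boxInf_le {lam m : ℝ} {μX : Measure X} {μY : Measure Y} {φX : ℝ → X} {φY : ℝ → Y}
    (hX : IsParameter μX m φX) (hY : IsParameter μY m φY) :
    boxInf lam m μX μY ≤ boxDist (lebIcc m) lam (pb φX) (pb φY) :=
  csInf_le ⟨0, by rintro _ ⟨_, _, _, _, rfl⟩; exact boxDist_nonneg _ _ _ _⟩ ⟨_, _, hX, hY, rfl⟩

end Infima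

section Main

variable {X Y : Type*}
    [MetricSpace X] [CompleteSpace X] [TopologicalSpace.SeparableSpace X]
    [MeasurableSpace X] [BorelSpace X]
    [MetricSpace Y] [CompleteSpace Y] [TopologicalSpace.SeparableSpace Y]
    [MeasurableSpace Y] [BorelSpace Y]

lemma obsInf_le_boxInf_of_bdd {m : ℝ} {μX : Measure X} {μY : Measure Y}
    (hbX : EssBdd μX fun x y => dist x y) (hbY : EssBdd μY fun x y => dist x y) :
    obsInf 0 m μX μY ≤ boxInf 0 m μX μY ∧ boxInf 0 m μX μY ≤ 2 * obsInf 0 m μX μY := by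
  have := UniformSpace.secondCountable_of_separable X
  have := UniformSpace.secondCountable_of_separable Y
  by_cases hne : ∃ (φX : ℝ → X) (φY : ℝ → Y), IsParameter μX m φX ∧ IsParameter μY m φY
  · obtain ⟨φX, φY, hX, hY⟩ := hne
    constructor
    · refine le_csInf ⟨_, φX, φY, hX, hY, rfl⟩ ?_
      rintro _ ⟨ψX, ψY, hX', hY', rfl⟩
      exact (obsInf_le hX' hY').trans
        (HL_le_boxDist (isSemiDist_pb _) (isSemiDist_pb _) (hbX.pullback hX') (hbY.pullback hY'))
    · suffices boxInf 0 m μX μY / 2 ≤ obsInf 0 m μX μY by linarith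
      refine le_csInf ⟨_, φX, φY, hX, hY, rfl⟩ ?_
      rintro _ ⟨ψX, ψY, hX', hY', rfl⟩
      have h1 := boxInf_le (lam := 0) hX' hY'
      have h2 := boxDist_le_two_HL hX'.1 hY'.1 (hbX.pullback hX') (hbY.pullback hY')
      linarith
  · have h1 : obsInf 0 m μX μY = 0 := by
      unfold obsInf
      convert Real.sInf_empty
      rw [eq_empty_iff_forall_notMem]
      rintro _ ⟨φX, φY, hX, hY, -⟩
      exact hne ⟨φX, φY, hX, hY⟩
    have h2 : boxInf 0 m μX μY = 0 := by
      unfold boxInf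
      convert Real.sInf_empty
      rw [eq_empty_iff_forall_notMem]
      rintro _ ⟨φX, φY, hX, hY, -⟩
      exact hne ⟨φX, φY, hX, hY⟩
    simp [h1, h2]

lemma obsInf_boxInf_nonpos_of_not_bdd (μX : Measure X) (μY : Measure Y) [IsFiniteMeasure μX]
    [IsFiniteMeasure μY] (hm : μX univ = μY univ)
    (hb : ¬ ((EssBdd μX fun x y => dist x y) ∧ EssBdd μY fun x y => dist x y)) :
    obsInf 0 (μX univ).toReal μX μY ≤ 0 ∧ boxInf 0 (μX univ).toReal μX μY ≤ 0 := by
  have := UniformSpace.secondCountable_of_separable X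
  have := UniformSpace.secondCountable_of_separable Y
  have h0 : μX ≠ 0 := by
    rintro rfl
    have hY : μY = 0 := by simpa using hm.symm
    subst hY
    exact hb ⟨⟨0, ∅, by simp, by simp⟩, ⟨0, ∅, by simp, by simp⟩⟩
  have h0' : μY ≠ 0 := by
    rintro rfl
    exact h0 (by simpa using hm)
  obtain ⟨φX, φY, hX, hY, hprod⟩ := exists_product_parameters μX μY hm h0
  constructor
  · exact (obsInf_le hX hY).trans (HL_nonpos_of_not_essBdd (isSemiDist_pb _) (isSemiDist_pb _)
      fun h => hb ⟨EssBdd.of_pullback hX h.1, EssBdd.of_pullback hY h.2⟩)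
  · refine (boxInf_le hX hY).trans (le_of_eq ?_)
    unfold boxDist
    rw [boxDist_zero_set]
    convert Real.sInf_empty
    rw [eq_empty_iff_forall_notMem]
    rintro ε ⟨-, T, hT, h⟩
    refine hb ⟨EssBdd.of_boxDist_set h0' hprod hT h,
      EssBdd.of_boxDist_set h0 (fun A B hA hB hA0 hB0 => ?_) hT
        (fun x hx y hy => by rw [abs_sub_comm]; exact h x hx y hy)⟩
    rw [inter_comm]
    exact hprod B A hB hA hB0 hA0

lemma obsInf_le_boxInf_le_two_obsInf (μX : Measure X) (μY : Measure Y) [IsFiniteMeasure μX]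
    [IsFiniteMeasure μY] (hm : μX univ = μY univ) :
    obsInf 0 (μX univ).toReal μX μY ≤ boxInf 0 (μX univ).toReal μX μY ∧
      boxInf 0 (μX univ).toReal μX μY ≤ 2 * obsInf 0 (μX univ).toReal μX μY := by
  by_cases hb : (EssBdd μX fun x y => dist x y) ∧ EssBdd μY fun x y => dist x y
  · exact obsInf_le_boxInf_of_bdd hb.1 hb.2
  · obtain ⟨h1, h2⟩ := obsInf_boxInf_nonpos_of_not_bdd μX μY hm hb
    have h3 := obsInf_nonneg 0 (μX univ).toReal μX μY
    have h4 := boxInf_nonneg 0 (μX univ).toReal μX μY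
    constructor <;> linarith

end Main

lemma smul_univ_eq_of_lt {X Y : Type*} [MeasurableSpace X] [MeasurableSpace Y] (μX : Measure X)
    (μY : Measure Y) [IsFiniteMeasure μX] [IsFiniteMeasure μY]
    (h : (μX univ).toReal < (μY univ).toReal) :
    (ENNReal.ofReal ((μX univ).toReal / (μY univ).toReal) • μY) univ = μX univ := by
  have h0 : 0 < (μY univ).toReal := lt_of_le_of_lt ENNReal.toReal_nonneg h
  have h1 : μY univ = ENNReal.ofReal (μY univ).toReal :=
    (ENNReal.ofReal_toReal (measure_ne_top _ _)).symm
  rw [Measure.smul_apply, smul_eq_mul]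
  nth_rewrite 2 [h1]
  rw [← ENNReal.ofReal_mul (by positivity), div_mul_cancel₀ _ h0.ne',
    ENNReal.ofReal_toReal (measure_ne_top _ _)]

/-- comparison between the observable distance and the box distance. -/
theorem obs_le_box_le_two_obs {X Y : Type*}
    [MetricSpace X] [CompleteSpace X] [TopologicalSpace.SeparableSpace X]
    [MeasurableSpace X] [BorelSpace X]
    [MetricSpace Y] [CompleteSpace Y] [TopologicalSpace.SeparableSpace Y]
    [MeasurableSpace Y] [BorelSpace Y]
    (μX : Measure X) (μY : Measure Y) [IsFiniteMeasure μX] [IsFiniteMeasure μY] :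
    mmObs 0 μX μY ≤ mmBox 0 μX μY ∧ mmBox 0 μX μY ≤ 2 * mmObs 0 μX μY := by
  unfold mmObs mmBox
  split_ifs with h1 h2
  · exact obsInf_le_boxInf_le_two_obsInf μX μY
      ((ENNReal.toReal_eq_toReal_iff' (measure_ne_top _ _) (measure_ne_top _ _)).1 h1)
  · have : IsFiniteMeasure (ENNReal.ofReal ((μX univ).toReal / (μY univ).toReal) • μY) :=
      Measure.smul_finite _ ENNReal.ofReal_ne_top
    have key := obsInf_le_boxInf_le_two_obsInf μX _ (smul_univ_eq_of_lt μX μY h2).symm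
    constructor <;> linarith [key.1, key.2]
  · have h3 : (μY univ).toReal < (μX univ).toReal := lt_of_le_of_ne (not_lt.1 h2) (Ne.symm h1)
    have : IsFiniteMeasure (ENNReal.ofReal ((μY univ).toReal / (μX univ).toReal) • μX) :=
      Measure.smul_finite _ ENNReal.ofReal_ne_top
    have hu := smul_univ_eq_of_lt μY μX h3
    have key := obsInf_le_boxInf_le_two_obsInf _ μY hu
    rw [hu] at key
    constructor <;> linarith [key.1, key.2]
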